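/- Let X ⊆ ℝ^d be a finite acute set, let u ∈ ℝ^d be nonzero and c ∈ ℝ, and suppose ⟨x,u⟩ ≤ c for every x ∈ X (X lies on one closed side of the hyperplane h = {x : ⟨x,u⟩ = c}). Then there exist a finite acute set X' ⊆ ℝ^{d+1}, a nonzero vector u' ∈ ℝ^{d+1}, and c' ∈ ℝ such that |X'| = |X| + |{x ∈ X : ⟨x,u⟩ = c}|, the number of points x ∈ X' with ⟨x,u'⟩ = c' equals |X|, and ⟨x,u'⟩ ≤ c' for every x ∈ X'. -/

import Mathlib

open scoped RealInnerProductSpace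

/-- A set of points in a real inner product space is *acute* if any three pairwise distinct
points of it form an acute triangle, i.e. every angle they determine is less than `π/2`. -/
def IsAcuteSet {V : Type*} [NormedAddCommGroup V] [InnerProductSpace ℝ V] (S : Set V) : Prop :=
  ∀ a ∈ S, ∀ b ∈ S, ∀ c ∈ S, a ≠ b → a ≠ c → b ≠ c →
    EuclideanGeometry.angle a b c < Real.pi / 2

open Filter Topology

section StepUp

variable {V : Type*} [NormedAddCommGroup V] [InnerProductSpace ℝ V]

theorem InnerProductGeometry.angle_lt_pi_div_two_iff_inner_pos {x y : V} :
    InnerProductGeometry.angle x y < Real.pi / 2 ↔ 0 < ⟪x, y⟫ := by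
  rw [InnerProductGeometry.angle, Real.arccos_lt_pi_div_two]
  constructor
  · intro h
    by_contra hn
    exact absurd h (not_lt.2 (div_nonpos_of_nonpos_of_nonneg (not_lt.1 hn) (by positivity)))
  · intro h
    have hx : x ≠ 0 := by rintro rfl; simp at h
    have hy : y ≠ 0 := by rintro rfl; simp at h
    positivity

theorem isAcuteSet_iff_inner_pos {S : Set V} :
    IsAcuteSet S ↔ ∀ a ∈ S, ∀ b ∈ S, ∀ c ∈ S, a ≠ b → a ≠ c → b ≠ c → 0 < ⟪a - b, c - b⟫ := by
  simp only [IsAcuteSet, EuclideanGeometry.angle,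
    InnerProductGeometry.angle_lt_pi_div_two_iff_inner_pos, vsub_eq_sub]

/-- In an acute set the angles, including the degenerate ones, have positive inner product. -/
theorem IsAcuteSet.inner_pos {S : Set V} (hS : IsAcuteSet S) {a b c : V} (ha : a ∈ S) (hb : b ∈ S)
    (hc : c ∈ S) (hab : a ≠ b) (hcb : c ≠ b) : 0 < ⟪a - b, c - b⟫ := by
  by_cases hac : a = c
  · subst hac
    exact real_inner_self_pos.2 (sub_ne_zero.2 hab)
  · exact isAcuteSet_iff_inner_pos.1 hS a ha b hb c hc hab hac hcb.symm

/-- Small perturbations of a finite acute set remain acute. -/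
theorem IsAcuteSet.exists_perturb_radius {X : Finset V} (hX : IsAcuteSet (X : Set V)) :
    ∃ η > 0, ∀ a ∈ X, ∀ b ∈ X, ∀ c ∈ X, a ≠ b → c ≠ b → ∀ x y z : V, ‖x‖ < η → ‖y‖ < η →
      ‖z‖ < η → 0 < ⟪a + x - (b + y), c + z - (b + y)⟫ := by
  have key : ∀ᶠ t : V × V × V in 𝓝 0, ∀ a ∈ X, ∀ b ∈ X, ∀ c ∈ X, a ≠ b → c ≠ b →
      0 < ⟪a + t.1 - (b + t.2.1), c + t.2.2 - (b + t.2.1)⟫ := by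
    simp only [eventually_all_finset, eventually_imp_distrib_left]
    intro a ha b hb c hc hab hcb
    have hcont : Continuous fun t : V × V × V =>
        ⟪a + t.1 - (b + t.2.1), c + t.2.2 - (b + t.2.1)⟫ := by fun_prop
    refine hcont.continuousAt.eventually_const_lt ?_
    simpa using hX.inner_pos ha hb hc hab hcb
  obtain ⟨η, hη, h⟩ := Metric.eventually_nhds_iff.1 key
  refine ⟨η, hη, fun a ha b hb c hc hab hcb x y z hx hy hz => ?_⟩
  exact h (y := (x, y, z)) (by simp [Prod.norm_def, hx, hy, hz]) a ha b hb c hc hab hcb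

/-- For each point of a finite acute set there is a direction making acute angles with all
segments to the other points. -/
theorem IsAcuteSet.exists_inner_pos {X : Finset V} (hX : IsAcuteSet (X : Set V)) :
    ∃ w : V → V, ∀ p ∈ X, ∀ x ∈ X, x ≠ p → 0 < ⟪w p, x - p⟫ := by
  refine ⟨fun p => ∑ y ∈ X, (y - p), fun p hp x hx hxp => ?_⟩
  rw [sum_inner]
  refine Finset.sum_pos' (fun y hy => ?_) ⟨x, hx, hX.inner_pos hx hp hx hxp hxp⟩
  by_cases hyp : y = p
  · simp [hyp]
  · exact (hX.inner_pos hy hp hx hyp hxp).le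

/-- Translation vectors of equal length, tilted by distinct amounts in the plane of `e` and `u`. -/
theorem exists_tilted_translations {X P : Finset V} (hPX : P ⊆ X) {e u : V} {c : ℝ}
    (he : ‖e‖ = 1) (hu : ‖u‖ = 1) (hue : ⟪u, e⟫ = 0) (hXe : ∀ x ∈ X, ⟪e, x⟫ = 0)
    (hXu : ∀ x ∈ X, ⟪u, x⟫ ≤ c) (hPu : ∀ p ∈ P, ⟪u, p⟫ = c) {η : ℝ} (hη : 0 < η) :
    ∃ b : V → V, ∀ p ∈ P, ‖b p‖ = η ∧ 0 < ⟪b p, e⟫ ∧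
      (∀ x ∈ X, 0 ≤ ⟪b p, x - p⟫ ∧ ⟪b p, x - (p + b p)⟫ < 0) ∧
      ∀ q ∈ P, q ≠ p → 0 < ⟪b p, q + b q - p⟫ ∧ ⟪b p, q + b q - (p + b p)⟫ < 0 := by
  obtain ⟨k, hk⟩ := Set.countable_iff_exists_injOn.1 P.countable_toSet
  have heu : ⟪e, u⟫ = 0 := by rw [real_inner_comm, hue]
  have hee : ⟪e, e⟫ = 1 := by simp [he]
  have huu : ⟪u, u⟫ = 1 := by simp [hu]
  set b : ℝ → V → V := fun σ p => η • (Real.cos (σ * k p) • e - Real.sin (σ * k p) • u) with hb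
  have hbb : ∀ σ p q, ⟪b σ p, b σ q⟫ = η ^ 2 * Real.cos (σ * k p - σ * k q) := by
    intro σ p q
    simp only [hb, inner_smul_left, inner_smul_right, inner_sub_left, inner_sub_right, heu, hue,
      hee, huu, Real.cos_sub, RCLike.conj_to_real]
    ring
  have hbe : ∀ σ p, ⟪b σ p, e⟫ = η * Real.cos (σ * k p) := by
    intro σ p
    simp [hb, inner_smul_left, inner_sub_left, hue, he]
  have hbx : ∀ σ, ∀ p ∈ P, ∀ x ∈ X,
      ⟪b σ p, x - p⟫ = η * Real.sin (σ * k p) * (c - ⟪u, x⟫) := by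
    intro σ p hp x hx
    simp only [hb, inner_smul_left, inner_sub_left, inner_sub_right, hXe x hx,
      hXe p (hPX hp), hPu p hp, RCLike.conj_to_real]
    ring
  have hsmall : ∀ᶠ σ in 𝓝[>] (0 : ℝ), 0 < σ ∧ ∀ p ∈ P, (0 < Real.cos (σ * k p) ∧ σ * k p < 1) ∧
      (∀ x ∈ X, η * Real.sin (σ * k p) * (c - ⟪u, x⟫) < η ^ 2) := by
    refine eventually_mem_nhdsWithin.and (Filter.Eventually.filter_mono nhdsWithin_le_nhds ?_)
    rw [eventually_all_finset]
    intro p hp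
    refine Eventually.and (Eventually.and ?_ ?_) ?_
    · have : Continuous fun σ : ℝ => Real.cos (σ * k p) := by fun_prop
      exact this.continuousAt.eventually_const_lt (by simp)
    · have : Continuous fun σ : ℝ => σ * k p := by fun_prop
      exact this.continuousAt.eventually_lt_const (by simp)
    · rw [eventually_all_finset]
      intro x hx
      have : Continuous fun σ : ℝ => η * Real.sin (σ * k p) * (c - ⟪u, x⟫) := by fun_prop
      refine this.continuousAt.eventually_lt_const ?_
      simp only [zero_mul, Real.sin_zero, mul_zero]
      positivity
  obtain ⟨σ, hσ, h⟩ := hsmall.exists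
  have hpi := Real.pi_gt_three
  have hη2 : 0 < η ^ 2 := by positivity
  have hself : ∀ p, ⟪b σ p, b σ p⟫ = η ^ 2 := fun p => by rw [hbb]; simp
  refine ⟨b σ, fun p hp => ⟨?_, ?_, fun x hx => ?_, fun q hq hqp => ?_⟩⟩
  · have := hself p
    rw [real_inner_self_eq_norm_sq] at this
    exact (sq_eq_sq₀ (norm_nonneg _) hη.le).1 this
  · rw [hbe]
    exact mul_pos hη (h p hp).1.1
  · rw [← sub_sub, inner_sub_right (b σ p) (x - p), hbx σ p hp x hx, hself]
    refine ⟨?_, by linarith [(h p hp).2 x hx]⟩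
    have hs : 0 ≤ Real.sin (σ * k p) :=
      Real.sin_nonneg_of_nonneg_of_le_pi (by positivity) (by linarith [(h p hp).1.2])
    exact mul_nonneg (mul_nonneg hη.le hs) (sub_nonneg.2 (hXu x hx))
  · have h0 : ⟪b σ p, q - p⟫ = 0 := by rw [hbx σ p hp q (hPX hq), hPu q hq]; simp
    have e1 : q + b σ q - p = (q - p) + b σ q := by abel
    have e2 : q + b σ q - (p + b σ p) = (q - p) + b σ q - b σ p := by abel
    rw [e2, e1, inner_sub_right, inner_add_right, h0, hbb, hself]
    have hp1 := (h p hp).1.2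
    have hq1 := (h q hq).1.2
    have hp0 : 0 ≤ σ * k p := by positivity
    have hq0 : 0 ≤ σ * k q := by positivity
    have hne : σ * k p - σ * k q ≠ 0 := by
      rw [← mul_sub]
      refine mul_ne_zero hσ.ne' (sub_ne_zero.2 fun hkk => hqp ?_)
      exact (hk hp hq (by exact_mod_cast hkk)).symm
    have hlt : Real.cos (σ * k p - σ * k q) < 1 := lt_of_le_of_ne (Real.cos_le_one _) fun h1 =>
      hne ((Real.cos_eq_one_iff_of_lt_of_lt (by linarith) (by linarith)).1 h1)
    have hpos : 0 < Real.cos (σ * k p - σ * k q) :=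
      Real.cos_pos_of_mem_Ioo ⟨by linarith, by linarith⟩
    constructor
    · positivity
    · nlinarith

/-- Translation vectors `v p` of length less than `η` such that every point of `X`, and every
translated point, apart from `p` and `p + v p`, lies strictly between the hyperplanes orthogonal
to `v p` through `p` and through `p + v p`. -/
theorem IsAcuteSet.exists_slab_translations {X P : Finset V} (hX : IsAcuteSet (X : Set V))
    (hPX : P ⊆ X) {e u : V} {c : ℝ} (he : ‖e‖ = 1) (hu : ‖u‖ = 1) (hue : ⟪u, e⟫ = 0)
    (hXe : ∀ x ∈ X, ⟪e, x⟫ = 0) (hXu : ∀ x ∈ X, ⟪u, x⟫ ≤ c) (hPu : ∀ p ∈ P, ⟪u, p⟫ = c)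
    {η : ℝ} (hη : 0 < η) :
    ∃ v : V → V, ∀ p ∈ P, ‖v p‖ < η ∧ 0 < ⟪v p, e⟫ ∧
      (∀ x ∈ X, x ≠ p → 0 < ⟪v p, x - p⟫ ∧ ⟪v p, x - (p + v p)⟫ < 0) ∧
      ∀ q ∈ P, q ≠ p → 0 < ⟪v p, q + v q - p⟫ ∧ ⟪v p, q + v q - (p + v p)⟫ < 0 := by
  obtain ⟨b, hb⟩ := exists_tilted_translations hPX he hu hue hXe hXu hPu (half_pos hη)
  obtain ⟨w, hw⟩ := hX.exists_inner_pos
  have key : ∀ᶠ ε in 𝓝[>] (0 : ℝ), 0 < ε ∧ ∀ p ∈ P, ‖b p + ε • w p‖ < η ∧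
      0 < ⟪b p + ε • w p, e⟫ ∧ (∀ x ∈ X, ⟪b p + ε • w p, x - (p + (b p + ε • w p))⟫ < 0) ∧
      ∀ q ∈ P, q ≠ p → 0 < ⟪b p + ε • w p, q + (b q + ε • w q) - p⟫ ∧
        ⟪b p + ε • w p, q + (b q + ε • w q) - (p + (b p + ε • w p))⟫ < 0 := by
    refine eventually_mem_nhdsWithin.and (Filter.Eventually.filter_mono nhdsWithin_le_nhds ?_)
    simp only [eventually_all_finset, eventually_and, eventually_imp_distrib_left]
    intro p hp
    obtain ⟨h1, h2, h3, h4⟩ := hb p hp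
    refine ⟨?_, ?_, fun x hx => ?_, fun q hq hqp => ⟨?_, ?_⟩⟩
    · exact Tendsto.eventually_lt_const (by simpa [h1] using hη) (Continuous.tendsto (by fun_prop) 0)
    · exact Tendsto.eventually_const_lt (by simpa using h2) (Continuous.tendsto (by fun_prop) 0)
    · exact Tendsto.eventually_lt_const (by simpa using (h3 x hx).2) (Continuous.tendsto (by fun_prop) 0)
    · exact Tendsto.eventually_const_lt (by simpa using (h4 q hq hqp).1) (Continuous.tendsto (by fun_prop) 0)
    · exact Tendsto.eventually_lt_const (by simpa using (h4 q hq hqp).2) (Continuous.tendsto (by fun_prop) 0)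
  obtain ⟨ε, hε, h⟩ := key.exists
  refine ⟨fun p => b p + ε • w p, fun p hp => ?_⟩
  obtain ⟨h1, h2, h3, h4⟩ := h p hp
  refine ⟨h1, h2, fun x hx hxp => ⟨?_, h3 x hx⟩, h4⟩
  rw [inner_add_left, real_inner_smul_left]
  have := ((hb p hp).2.2.1 x hx).1
  have := mul_pos hε (hw p (hPX hp) x hx hxp)
  linarith

/-- A finite acute set lying in the hyperplane `e^⊥` and on one side of a hyperplane orthogonal
to a unit vector `u ∈ e^⊥` can be enlarged by one new point, strictly above `e^⊥`, for each of
its points on the latter hyperplane. -/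
theorem IsAcuteSet.exists_union_translates {X P : Finset V} (hX : IsAcuteSet (X : Set V))
    (hPX : P ⊆ X) {e u : V} {c : ℝ} (he : ‖e‖ = 1) (hu : ‖u‖ = 1) (hue : ⟪u, e⟫ = 0)
    (hXe : ∀ x ∈ X, ⟪e, x⟫ = 0) (hXu : ∀ x ∈ X, ⟪u, x⟫ ≤ c) (hPu : ∀ p ∈ P, ⟪u, p⟫ = c) :
    ∃ Y : Finset V, Y.card = P.card ∧ (∀ y ∈ Y, 0 < ⟪e, y⟫) ∧
      IsAcuteSet (X ∪ Y : Set V) := by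
  classical
  obtain ⟨η, hη, hpert⟩ := hX.exists_perturb_radius
  obtain ⟨v, hv⟩ := hX.exists_slab_translations hPX he hu hue hXe hXu hPu hη
  have hslab : ∀ p ∈ P, ∀ x ∈ X, ∀ z, z = 0 ∨ x ∈ P ∧ z = v x → x ≠ p →
      0 < ⟪v p, x + z - p⟫ ∧ ⟪v p, x + z - (p + v p)⟫ < 0 := by
    rintro p hp x hx z (rfl | ⟨hxP, rfl⟩) hxp
    · simpa using (hv p hp).2.2.1 x hx hxp
    · exact (hv p hp).2.2.2 x hxP hxp
  have hnorm : ∀ x z, z = 0 ∨ x ∈ P ∧ z = v x → ‖z‖ < η := by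
    rintro x z (rfl | ⟨hxP, rfl⟩)
    · simpa using hη
    · exact (hv x hxP).1
  have hrep : ∀ y ∈ X ∪ P.image (fun p => p + v p),
      ∃ x ∈ X, ∃ z, (z = 0 ∨ x ∈ P ∧ z = v x) ∧ y = x + z := by
    intro y hy
    rcases Finset.mem_union.1 hy with hy | hy
    · exact ⟨y, hy, 0, Or.inl rfl, by simp⟩
    · obtain ⟨p, hp, rfl⟩ := Finset.mem_image.1 hy
      exact ⟨p, hPX hp, v p, Or.inr ⟨hp, rfl⟩, rfl⟩
  have hvert : ∀ p ∈ X, ∀ x ∈ X, ∀ y z t, (y = 0 ∨ p ∈ P ∧ y = v p) → (z = 0 ∨ p ∈ P ∧ z = v p) →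
      (t = 0 ∨ x ∈ P ∧ t = v x) → p + y ≠ p + z → p + y ≠ x + t → p + z ≠ x + t →
      0 < ⟪p + y - (p + z), x + t - (p + z)⟫ := by
    intro p _ x hx y z t hy hz ht hyz hyt hzt
    have hxp : x ≠ p := by
      rintro rfl
      rcases hy with rfl | ⟨-, rfl⟩ <;> rcases hz with rfl | ⟨-, rfl⟩ <;>
        rcases ht with rfl | ⟨-, rfl⟩ <;> simp_all
    rcases hy with rfl | ⟨hp, rfl⟩ <;> rcases hz with rfl | ⟨hp', rfl⟩
    · exact absurd rfl hyz
    · have := (hslab p hp' x hx t ht hxp).2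
      have e1 : p + 0 - (p + v p) = - v p := by abel
      rw [e1, inner_neg_left]
      linarith
    · simpa using (hslab p hp x hx t ht hxp).1
    · exact absurd rfl hyz
  refine ⟨P.image (fun p => p + v p), Finset.card_image_of_injOn fun p hp q hq hpq => ?_, ?_, ?_⟩
  · by_contra hne
    have := ((hv p hp).2.2.2 q hq (Ne.symm hne)).2
    rw [show q + v q = p + v p from hpq.symm, sub_self, inner_zero_right] at this
    exact this.false
  · intro y hy
    obtain ⟨p, hp, rfl⟩ := Finset.mem_image.1 hy
    rw [inner_add_right, hXe p (hPX hp), zero_add, real_inner_comm]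
    exact (hv p hp).2.1
  · rw [← Finset.coe_union, isAcuteSet_iff_inner_pos]
    intro a' ha' b' hb' c' hc' hab hac hbc
    obtain ⟨a, ha, x, hx, rfl⟩ := hrep a' ha'
    obtain ⟨b, hb, y, hy, rfl⟩ := hrep b' hb'
    obtain ⟨c, hc, z, hz, rfl⟩ := hrep c' hc'
    by_cases h1 : a = b
    · subst h1
      exact hvert a ha c hc x y z hx hy hz hab hac hbc
    by_cases h2 : c = b
    · subst h2
      rw [real_inner_comm]
      exact hvert c hc a ha z y x hz hy hx hbc.symm hac.symm hab.symm
    exact hpert a ha b hb c hc h1 h2 x y z (hnorm a x hx) (hnorm b y hy) (hnorm c z hz)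

end StepUp

/-- The embedding of `ℝ^d` in `ℝ^{d+1}` as the hyperplane of points with last coordinate `0`. -/
noncomputable def EuclideanSpace.snocZero (d : ℕ) :
    EuclideanSpace ℝ (Fin d) →ₗᵢ[ℝ] EuclideanSpace ℝ (Fin (d + 1)) where
  toFun x := WithLp.toLp 2 (Fin.snoc (α := fun _ => ℝ) x 0)
  map_add' x y := by
    ext i
    refine Fin.lastCases ?_ (fun j => ?_) i <;> simp
  map_smul' r x := by
    ext i
    refine Fin.lastCases ?_ (fun j => ?_) i <;> simp
  norm_map' x := by
    simp [EuclideanSpace.norm_eq, Fin.sum_univ_castSucc]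

theorem EuclideanSpace.inner_single_last_snocZero {d : ℕ} (x : EuclideanSpace ℝ (Fin d)) :
    ⟪EuclideanSpace.single (Fin.last d) (1 : ℝ), EuclideanSpace.snocZero d x⟫ = 0 := by
  simp [EuclideanSpace.inner_single_left, EuclideanSpace.snocZero]

/-- If `X ⊆ ℝ^d` is a finite acute set lying on one closed side of a hyperplane
`h = {x : ⟪x,u⟫ = c}`, then there are a finite acute set `X' ⊆ ℝ^{d+1}` and a hyperplane
`H = {x : ⟪x,u'⟫ = c'}` such that `|X'| = |X| + |X ∩ h|`, `|X' ∩ H| = |X|`, and `X'` lies on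
one closed side of `H`. -/
theorem acute_set_step_up_dim {d : ℕ}
    (X : Finset (EuclideanSpace ℝ (Fin d)))
    (hX : IsAcuteSet (X : Set (EuclideanSpace ℝ (Fin d))))
    (u : EuclideanSpace ℝ (Fin d)) (hu : u ≠ 0) (c : ℝ)
    (hside : ∀ x ∈ X, ⟪x, u⟫ ≤ c) :
    ∃ (X' : Finset (EuclideanSpace ℝ (Fin (d + 1))))
      (u' : EuclideanSpace ℝ (Fin (d + 1))) (c' : ℝ),
      u' ≠ 0 ∧
      IsAcuteSet (X' : Set (EuclideanSpace ℝ (Fin (d + 1)))) ∧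
      X'.card = X.card + {x : EuclideanSpace ℝ (Fin d) | x ∈ X ∧ ⟪x, u⟫ = c}.ncard ∧
      {x : EuclideanSpace ℝ (Fin (d + 1)) | x ∈ X' ∧ ⟪x, u'⟫ = c'}.ncard = X.card ∧
      ∀ x ∈ X', ⟪x, u'⟫ ≤ c' := by
  classical
  set ι := EuclideanSpace.snocZero d
  set e : EuclideanSpace ℝ (Fin (d + 1)) := EuclideanSpace.single (Fin.last d) (1 : ℝ) with he
  have hιe : ∀ x, ⟪e, ι x⟫ = 0 := EuclideanSpace.inner_single_last_snocZero
  have hnu : 0 < ‖u‖ := norm_pos_iff.2 hu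
  have hnorm : ‖ι (‖u‖⁻¹ • u)‖ = 1 := by
    rw [ι.norm_map, norm_smul, norm_inv, norm_norm, inv_mul_cancel₀ hnu.ne']
  have hinner : ∀ x, ⟪ι (‖u‖⁻¹ • u), ι x⟫ = ‖u‖⁻¹ * ⟪x, u⟫ := fun x => by
    rw [ι.inner_map_map, real_inner_smul_left, real_inner_comm]
  have hιX : IsAcuteSet ((X.image ι : Finset _) : Set (EuclideanSpace ℝ (Fin (d + 1)))) := by
    rw [isAcuteSet_iff_inner_pos] at hX ⊢
    simp only [Finset.coe_image, Set.forall_mem_image, ne_eq, ι.injective.eq_iff, ← map_sub,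
      ι.inner_map_map]
    exact hX
  obtain ⟨Y, hYcard, hYe, hacute⟩ := hιX.exists_union_translates
    (P := (X.filter fun x => ⟪x, u⟫ = c).image ι) (e := e) (u := ι (‖u‖⁻¹ • u)) (c := ‖u‖⁻¹ * c)
    (Finset.image_subset_image (Finset.filter_subset _ _)) (by simp [he]) hnorm
    (by rw [real_inner_comm, hιe]) (by simp [hιe])
    (by
      simp only [Finset.forall_mem_image, hinner]
      intro x hx
      have := hside x hx
      gcongr)
    (by
      simp only [Finset.forall_mem_image, hinner, Finset.mem_filter]
      rintro x ⟨-, hx⟩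
      rw [hx])
  have hXcard : (X.image ι).card = X.card := Finset.card_image_of_injective _ ι.injective
  have hXe : ∀ x ∈ X.image ι, ⟪e, x⟫ = 0 := by simp [hιe]
  refine ⟨X.image ι ∪ Y, -e, 0, by simp [he], by rwa [Finset.coe_union], ?_, ?_, ?_⟩
  · rw [Finset.card_union_of_disjoint, hXcard, hYcard,
      Finset.card_image_of_injective _ ι.injective,
      ← Set.ncard_coe_finset (X.filter _), Finset.coe_filter]
    exact Finset.disjoint_left.2 fun x hx hy => (hYe x hy).ne' (hXe x hx)
  · rw [← hXcard, ← Set.ncard_coe_finset]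
    congr 1
    ext x
    simp only [Set.mem_ofPred_eq, Finset.mem_coe, Finset.mem_union, inner_neg_right, neg_eq_zero,
      real_inner_comm e x]
    constructor
    · rintro ⟨hx | hx, h0⟩
      · exact hx
      · exact absurd h0 (hYe x hx).ne'
    · exact fun hx => ⟨Or.inl hx, hXe x hx⟩
  · intro x hx
    rw [inner_neg_right, real_inner_comm, neg_nonpos]
    rcases Finset.mem_union.1 hx with hx | hx
    · exact (hXe x hx).ge
    · exact (hYe x hx).le
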